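/- Let A be a finite set and μ a stationary probability measure on A^ℤ. Then the μ-completions of the past tail σ-algebra T← = ∩_{m≥0} F_{−∞}^{−m} and the future tail σ-algebra T→ = ∩_{m≥0} F_m^∞ coincide. -/

import Mathlib

open MeasureTheory

/-- The left shift on `A^ℤ`. -/
def shiftZ {A : Type*} (ω : ℤ → A) : ℤ → A := fun n => ω (n + 1)

/-- The σ-algebra on `A^ℤ` generated by the coordinates with index in `s`. -/
def coordSigma (A : Type*) [MeasurableSpace A] (s : Set ℤ) : MeasurableSpace (ℤ → A) :=
  ⨆ k ∈ s, MeasurableSpace.comap (fun ω : ℤ → A => ω k) inferInstance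

/-- The past tail σ-algebra `∩_m σ(…, ζ_{-m-1}, ζ_{-m})`. -/
def pastTail (A : Type*) [MeasurableSpace A] : MeasurableSpace (ℤ → A) :=
  ⨅ m : ℕ, coordSigma A (Set.Iic (-(m : ℤ)))

/-- The future tail σ-algebra `∩_m σ(ζ_m, ζ_{m+1}, …)`. -/
def futureTail (A : Type*) [MeasurableSpace A] : MeasurableSpace (ℤ → A) :=
  ⨅ m : ℕ, coordSigma A (Set.Ici (m : ℤ))

theorem exists_nat_neg_le (s : Finset ℤ) : ∃ l : ℕ, ∀ i ∈ s, -(l : ℤ) ≤ i := by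
  refine ⟨s.sup Int.natAbs, fun i hi => ?_⟩
  have := Finset.le_sup (f := Int.natAbs) hi
  lia

open Filter Topology Finset in
theorem exists_future_of_exists_past (f : Finset ℤ → Finset ℤ → ℝ)
    (hmono : ∀ s s' t t', s ⊆ s' → t ⊆ t' → f s t ≤ f s' t')
    (hsub : ∀ s s' t t', f (s ∪ s') (t ∪ t') + f (s ∩ s') (t ∩ t') ≤ f s t + f s' t')
    (hzero : f ∅ ∅ = 0)
    (hshift : ∀ (k : ℤ) s t, f (s.image (· + k)) (t.image (· + k)) = f s t)
    (hpast : ∀ m : ℤ, ∀ ε > 0, ∃ s, (∀ i ∈ s, i ≤ m) ∧ f s {0} - f s ∅ < ε) :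
    ∀ m : ℤ, ∀ ε > 0, ∃ s, (∀ i ∈ s, m ≤ i) ∧ f s {0} - f s ∅ < ε := by
  have anti : ∀ s s' t t', s ⊆ s' → t ⊆ t' → f s' t' - f s t' ≤ f s' t - f s t := by
    intro s s' t t' hs ht
    have := hsub s' s t t'
    rw [union_eq_left.2 hs, union_eq_right.2 ht, inter_eq_right.2 hs, inter_eq_left.2 ht] at this
    linarith
  have shiftI : ∀ (k a b : ℤ) t, f (Ico (a + k) (b + k)) (t.image (· + k)) = f (Ico a b) t := by
    intro k a b t
    rw [← hshift k (Ico a b), image_add_right_Ico]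
  have shiftI0 : ∀ (k a b : ℤ), f (Ico (a + k) (b + k)) ∅ = f (Ico a b) ∅ := by
    intro k a b
    simpa using shiftI k a b ∅
  have subadd : ∀ s y, f s y - f s ∅ ≤ ∑ j ∈ y, (f s {j} - f s ∅) := by
    intro s y
    induction y using Finset.induction_on with
    | empty => simp
    | insert a y ha ih =>
      rw [sum_insert ha]
      have := hsub s s {a} y
      rw [union_self, inter_self, singleton_inter_of_notMem ha, ← insert_eq] at this
      linarith
  -- the block entropies and the entropy rate
  set F : ℕ → ℝ := fun n => f (Ico 0 (n : ℤ)) ∅ with hF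
  set g : ℕ → ℝ := fun n => F (n + 1) - F n with hg
  have g_nonneg : ∀ n, 0 ≤ g n := fun n =>
    sub_nonneg.2 (hmono _ _ _ _ (Ico_subset_Ico_right (by push_cast; lia)) subset_rfl)
  have g_anti : Antitone g := by
    refine antitone_nat_of_succ_le fun n => ?_
    have h1 := hsub (Ico 1 ((n : ℤ) + 1 + 1)) (Ico 0 ((n : ℤ) + 1)) ∅ ∅
    have e1 : Ico 1 ((n : ℤ) + 1 + 1) ∪ Ico 0 ((n : ℤ) + 1) = Ico 0 ((n : ℤ) + 1 + 1) := by
      ext i; simp only [mem_union, mem_Ico]; lia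
    have e2 : Ico 1 ((n : ℤ) + 1 + 1) ∩ Ico 0 ((n : ℤ) + 1) = Ico 1 ((n : ℤ) + 1) := by
      ext i; simp only [mem_inter, mem_Ico]; lia
    have h2 := shiftI0 1 0 n
    have h3 := shiftI0 1 0 (n + 1)
    simp only [zero_add] at h2 h3
    rw [e1, e2, union_self, inter_self, h2, h3] at h1
    simp only [hg, hF]
    push_cast
    linarith
  have g_bdd : BddBelow (Set.range g) := ⟨0, by rintro _ ⟨n, rfl⟩; exact g_nonneg n⟩
  set h := ⨅ n, g n with hh
  have g_tendsto : Tendsto g atTop (𝓝 h) := tendsto_atTop_ciInf g_anti g_bdd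
  have h_le : ∀ n, h ≤ g n := fun n => ciInf_le g_bdd n
  have F_zero : F 0 = 0 := by simpa [hF] using hzero
  have F_add : ∀ L N, N * h ≤ F (L + N) - F L := by
    intro L N
    induction N with
    | zero => simp
    | succ N ih =>
      have := h_le (L + N)
      simp only [hg] at this
      push_cast
      rw [← add_assoc]
      linarith
  have F_tendsto : Tendsto (fun n : ℕ => (n : ℝ)⁻¹ * F n) atTop (𝓝 h) := by
    have := g_tendsto.cesaro
    simpa only [hg, sum_range_sub, F_zero, sub_zero] using this
  have single_shift : ∀ (s : Finset ℤ) (j : ℤ),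
      f (s.image (· + j)) {j} - f (s.image (· + j)) ∅ = f s {0} - f s ∅ := by
    intro s j
    have h1 := hshift j s {0}
    have h2 := hshift j s ∅
    simp only [image_singleton, zero_add, image_empty] at h1 h2
    rw [h1, h2]
  have anti0 : ∀ s s' t, s ⊆ s' → f s' t - f s' ∅ ≤ f s t - f s ∅ := by
    intro s s' t hs
    have := anti s s' ∅ t hs (empty_subset _)
    linarith
  have sublinear : ∀ ε > 0, ∃ K : ℝ, ∀ N : ℕ, f ∅ (Ico 0 (N : ℤ)) ≤ F N - N * h + N * ε + K := by
    intro ε hε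
    obtain ⟨s, hs, hsε⟩ := hpast 0 ε hε
    obtain ⟨l, hl⟩ : ∃ l : ℕ, ∀ i ∈ s, -(l : ℤ) ≤ i := exists_nat_neg_le s
    refine ⟨l * f ∅ {0} + 1, fun N => ?_⟩
    have K0 : 0 ≤ f ∅ {0} := hzero ▸ hmono _ _ _ _ subset_rfl (empty_subset _)
    have upper : f (Ico 0 (N : ℤ)) (Ico 0 (N : ℤ)) - F N ≤ N * ε + l * f ∅ {0} := by
      refine (subadd _ _).trans ?_
      calc ∑ j ∈ Ico 0 (N : ℤ), (f (Ico 0 (N : ℤ)) {j} - f (Ico 0 (N : ℤ)) ∅)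
          ≤ ∑ j ∈ Ico 0 (N : ℤ), (ε + if j < l then f ∅ {0} else 0) := by
            refine sum_le_sum fun j hj => ?_
            rw [mem_Ico] at hj
            split_ifs with hjl
            · have h1 := anti0 ∅ (Ico 0 (N : ℤ)) {j} (empty_subset _)
              have h2 := single_shift ∅ j
              rw [image_empty] at h2
              linarith
            · have h1 := anti0 (s.image (· + j)) (Ico 0 (N : ℤ)) {j} (by
                intro i hi
                obtain ⟨i, his, rfl⟩ := mem_image.1 hi
                have := hs i his
                have := hl i his
                rw [mem_Ico]
                lia)
              have h2 := single_shift s j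
              linarith
        _ = N * ε + #((Ico (0 : ℤ) N).filter (· < (l : ℤ))) * f ∅ {0} := by
            rw [sum_add_distrib, ← sum_filter]
            simp
        _ ≤ N * ε + l * f ∅ {0} := by
            have : #((Ico (0 : ℤ) N).filter (· < (l : ℤ))) ≤ #(Ico 0 (l : ℤ)) := by
              refine card_le_card fun i hi => ?_
              simp only [mem_filter, mem_Ico] at hi ⊢
              lia
            rw [Int.card_Ico, sub_zero, Int.toNat_natCast] at this
            gcongr
    have lower : N * h - 1 ≤ f (Ico 0 (N : ℤ)) (Ico 0 (N : ℤ)) - f ∅ (Ico 0 (N : ℤ)) := by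
      obtain ⟨s, hs, hsε⟩ := hpast (-(N : ℤ)) ((N + 1 : ℝ)⁻¹) (by positivity)
      obtain ⟨L, hL⟩ : ∃ L : ℕ, ∀ i ∈ s, -(L : ℤ) ≤ i := exists_nat_neg_le s
      have h1 : f (Ico (-L : ℤ) 0) (Ico 0 (N : ℤ)) - f (Ico (-L : ℤ) 0) ∅ ≤ 1 := by
        refine (subadd _ _).trans ?_
        calc ∑ j ∈ Ico 0 (N : ℤ), (f (Ico (-L : ℤ) 0) {j} - f (Ico (-L : ℤ) 0) ∅)
            ≤ ∑ j ∈ Ico 0 (N : ℤ), (N + 1 : ℝ)⁻¹ := by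
              refine sum_le_sum fun j hj => ?_
              rw [mem_Ico] at hj
              have h1 := anti0 (s.image (· + j)) (Ico (-L : ℤ) 0) {j} (by
                intro i hi
                obtain ⟨i, his, rfl⟩ := mem_image.1 hi
                have := hs i his
                have := hL i his
                rw [mem_Ico]
                lia)
              have h2 := single_shift s j
              linarith
          _ ≤ 1 := by
              simp only [sum_const, Int.card_Ico, sub_zero, Int.toNat_natCast, nsmul_eq_mul]
              rw [← div_eq_mul_inv, div_le_one (by positivity)]
              linarith
      have h2 := hsub (Ico 0 (N : ℤ)) (Ico (-L : ℤ) 0) (Ico 0 (N : ℤ)) (Ico 0 (N : ℤ))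
      have e1 : Ico 0 (N : ℤ) ∪ Ico (-L : ℤ) 0 = Ico (-L : ℤ) N := by
        ext i; simp only [mem_union, mem_Ico]; lia
      have e2 : Ico 0 (N : ℤ) ∩ Ico (-L : ℤ) 0 = ∅ := by
        ext i; simp only [mem_inter, mem_Ico, notMem_empty]; lia
      rw [e1, e2, union_self, inter_self] at h2
      have h3 : f (Ico (-L : ℤ) N) ∅ ≤ f (Ico (-L : ℤ) N) (Ico 0 (N : ℤ)) :=
        hmono _ _ _ _ subset_rfl (empty_subset _)
      have h4 : f (Ico (-L : ℤ) N) ∅ = F (L + N) := by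
        rw [← shiftI0 L]
        simp only [hF]
        push_cast
        congr 2 <;> ring
      have h5 : f (Ico (-L : ℤ) 0) ∅ = F L := by
        rw [← shiftI0 L]
        simp [hF]
      have := F_add L N
      linarith
    linarith
  -- conditional entropies given the infinite future
  set u : ℤ → Finset ℤ → ℤ → ℝ := fun m y n => f (Ico m n) y - f (Ico m n) ∅ with hu
  have u_nonneg : ∀ m y n, 0 ≤ u m y n := fun m y n =>
    sub_nonneg.2 (hmono _ _ _ _ subset_rfl (empty_subset _))
  have u_anti : ∀ m y, Antitone (u m y) := fun m y a b hab =>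
    anti0 _ _ _ (Ico_subset_Ico_right hab)
  have u_bdd : ∀ m y, BddBelow (Set.range (u m y)) := fun m y =>
    ⟨0, by rintro _ ⟨n, rfl⟩; exact u_nonneg m y n⟩
  set c : ℤ → Finset ℤ → ℝ := fun m y => ⨅ n, u m y n with hc
  have c_tendsto : ∀ m y, Tendsto (u m y) atTop (𝓝 (c m y)) := fun m y =>
    tendsto_atTop_ciInf (u_anti m y) (u_bdd m y)
  have c_nonneg : ∀ m y, 0 ≤ c m y := fun m y => le_ciInf (u_nonneg m y)
  have c_le : ∀ m y, c m y ≤ f ∅ y := by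
    intro m y
    refine (ciInf_le (u_bdd m y) m).trans ?_
    simp [hu, hzero]
  have c_shift : ∀ k m y, c (m + k) (y.image (· + k)) = c m y := by
    intro k m y
    have h1 := (c_tendsto (m + k) (y.image (· + k))).comp
      (tendsto_atTop_add_const_right _ k tendsto_id)
    refine tendsto_nhds_unique h1 ((c_tendsto m y).congr fun n => ?_)
    simp only [hu, Function.comp, id, shiftI, shiftI0]
  have c_incr : ∀ m x y, x ⊆ y → c (m + 1) x - c m x ≤ c (m + 1) y - c m y := by
    intro m x y hxy
    refine le_of_tendsto_of_tendsto' ((c_tendsto _ x).sub (c_tendsto _ x))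
      ((c_tendsto _ y).sub (c_tendsto _ y)) fun n => ?_
    have := anti (Ico (m + 1) n) (Ico m n) x y (Ico_subset_Ico_left (by lia)) hxy
    simp only [hu]
    linarith
  have c_mono : ∀ m y, c m y ≤ c (m + 1) y := fun m y =>
    le_of_tendsto_of_tendsto' (c_tendsto _ y) (c_tendsto _ y) fun n =>
      anti0 _ _ _ (Ico_subset_Ico_left (by lia))
  have c_const : ∀ j : ℤ, c 1 {j} ≤ c 0 {j} := by
    intro j
    have key : ∀ N : ℕ, N * (c 1 {j} - c 0 {j}) ≤ f ∅ (Ico 0 (N : ℤ)) := by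
      intro N
      have h1 : f ∅ (Ico 0 (N : ℤ)) = f ∅ (Ico j (N + j)) := by
        rw [← hshift j, image_add_right_Ico, image_empty, zero_add]
      rw [h1]
      have h2 : ∑ m ∈ range N, (c 1 {j} - c 0 {j}) ≤
          ∑ m ∈ range N, (c ((m + 1 : ℕ) : ℤ) (Ico j (N + j)) - c m (Ico j (N + j))) := by
        refine sum_le_sum fun m hm => ?_
        rw [mem_range] at hm
        have h3 := c_incr m {j + m} (Ico j (N + j)) (by
          rw [singleton_subset_iff, mem_Ico]; lia)
        have h4 := c_shift m 0 {j}
        have h5 := c_shift m 1 {j}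
        simp only [image_singleton, zero_add] at h4 h5
        rw [add_comm (1 : ℤ)] at h5
        push_cast
        linarith
      rw [sum_const, card_range, nsmul_eq_mul,
        sum_range_sub (fun m : ℕ => c m (Ico j (N + j)))] at h2
      have := c_nonneg ((0 : ℕ) : ℤ) (Ico j (N + j))
      have := c_le N (Ico j (N + j))
      linarith
    refine sub_nonpos.1 (le_of_forall_pos_le_add fun ε hε => ?_)
    obtain ⟨K, hK⟩ := sublinear ε hε
    have lim : Tendsto (fun N : ℕ => (N : ℝ)⁻¹ * F N - h + ε + (N : ℝ)⁻¹ * K) atTop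
        (𝓝 (h - h + ε + 0 * K)) :=
      ((F_tendsto.sub_const h).add_const ε).add
        (tendsto_inv_atTop_nhds_zero_nat.mul_const K)
    have := ge_of_tendsto lim (b := c 1 {j} - c 0 {j}) (by
      filter_upwards [eventually_gt_atTop 0] with N hN
      have hN' : (0 : ℝ) < N := by exact_mod_cast hN
      have h1 := (key N).trans (hK N)
      have h2 : c 1 {j} - c 0 {j} ≤ (N : ℝ)⁻¹ * (F N - N * h + N * ε + K) := by
        rwa [inv_mul_eq_div, le_div_iff₀' hN']
      refine h2.trans_eq ?_
      field_simp)
    linarith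
  have c_succ : ∀ m : ℤ, c (m + 1) {0} = c m {0} := by
    intro m
    refine le_antisymm ?_ (c_mono m _)
    have h1 := c_shift (-m) m {0}
    have h2 := c_shift (-m) (m + 1) {0}
    simp only [image_singleton, zero_add] at h1 h2
    rw [← h1, ← h2]
    rw [add_neg_cancel, add_neg_cancel_comm]
    exact c_const (-m)
  have c_eq : ∀ m : ℤ, c m {0} = c 0 {0} := by
    intro m
    induction m using Int.induction_on with
    | zero => rfl
    | succ i ih => rw [c_succ, ih]
    | pred i ih => rw [← ih, ← c_succ, sub_add_cancel]
  have c_zero : c 0 {0} = 0 := by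
    refine le_antisymm (le_of_forall_pos_le_add fun ε hε => ?_) (c_nonneg _ _)
    obtain ⟨s, hs, hsε⟩ := hpast 0 ε hε
    obtain ⟨l, hl⟩ : ∃ l : ℕ, ∀ i ∈ s, -(l : ℤ) ≤ i := exists_nat_neg_le s
    rw [← c_eq (-l)]
    have h1 : c (-l) {0} ≤ u (-l) {0} 1 := ciInf_le (u_bdd _ _) 1
    have h2 : u (-l) {0} 1 ≤ f s {0} - f s ∅ := anti0 _ _ _ fun i hi => by
      have := hs i hi
      have := hl i hi
      rw [mem_Ico]
      lia
    linarith
  intro m ε hε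
  obtain ⟨n, hn⟩ := exists_lt_of_ciInf_lt (show c m {0} < ε by rw [c_eq, c_zero]; exact hε)
  exact ⟨Ico m n, fun i hi => (mem_Ico.1 hi).1, hn⟩

open Real Finset in
theorem sum_negMulLog_submodular {S T U : Type*} [Fintype S] [Fintype T] [Fintype U]
    (p : S → T → U → ℝ) (hp : ∀ x y z, 0 ≤ p x y z) :
    ∑ x, ∑ y, ∑ z, negMulLog (p x y z) + ∑ z, negMulLog (∑ x, ∑ y, p x y z) ≤
      ∑ x, ∑ z, negMulLog (∑ y, p x y z) + ∑ y, ∑ z, negMulLog (∑ x, p x y z) := by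
  set a : S → U → ℝ := fun x z => ∑ y, p x y z with ha
  set b : T → U → ℝ := fun y z => ∑ x, p x y z with hb
  set c : U → ℝ := fun z => ∑ x, ∑ y, p x y z with hc
  have hpa : ∀ x y z, p x y z ≤ a x z := fun x y z =>
    single_le_sum (f := fun y => p x y z) (fun y _ => hp x y z) (mem_univ y)
  have hpb : ∀ x y z, p x y z ≤ b y z := fun x y z =>
    single_le_sum (f := fun x => p x y z) (fun x _ => hp x y z) (mem_univ x)
  have hac : ∀ x z, a x z ≤ c z := fun x z =>
    single_le_sum (f := fun x => a x z) (fun x _ => sum_nonneg fun y _ => hp x y z) (mem_univ x)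
  have hbc : ∀ z, ∑ y, b y z = c z := fun z => sum_comm
  have pointwise : ∀ x y z, p x y z - a x z * b y z / c z ≤
      p x y z * log (p x y z) + p x y z * log (c z) -
        p x y z * log (a x z) - p x y z * log (b y z) := by
    intro x y z
    rcases (hp x y z).eq_or_lt with h0 | h0
    · rw [← h0]
      have : 0 ≤ a x z * b y z / c z := by
        have := (hp x y z).trans (hpa x y z)
        have := (hp x y z).trans (hpb x y z)
        have := ((hp x y z).trans (hpa x y z)).trans (hac x z)
        positivity
      linarith
    · have ha0 := h0.trans_le (hpa x y z)
      have hb0 := h0.trans_le (hpb x y z)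
      have hc0 := ha0.trans_le (hac x z)
      have h1 := log_le_sub_one_of_pos (x := a x z * b y z / (c z * p x y z)) (by positivity)
      rw [log_div (by positivity) (by positivity), log_mul ha0.ne' hb0.ne',
        log_mul hc0.ne' h0.ne'] at h1
      have h2 := mul_le_mul_of_nonneg_left h1 h0.le
      have h3 : p x y z * (a x z * b y z / (c z * p x y z) - 1) =
          a x z * b y z / c z - p x y z := by
        field_simp
      rw [h3] at h2
      linarith
  have swap : ∀ q : S → T → U → ℝ,
      ∑ x, ∑ y, ∑ z, q x y z = ∑ z, ∑ x, ∑ y, q x y z := by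
    intro q
    rw [sum_comm (s := (univ : Finset U))]
    exact sum_congr rfl fun x _ => sum_comm
  have total : ∑ x, ∑ y, ∑ z, (p x y z - a x z * b y z / c z) = 0 := by
    rw [swap]
    refine sum_eq_zero fun z _ => ?_
    simp only [sum_sub_distrib]
    simp_rw [← sum_div, ← mul_sum, hbc, ← sum_mul]
    exact sub_eq_zero.2 (mul_self_div_self (c z)).symm
  have pointwise_sum : 0 ≤ ∑ x, ∑ y, ∑ z, (p x y z * log (p x y z) + p x y z * log (c z) -
      p x y z * log (a x z) - p x y z * log (b y z)) :=
    total.symm.le.trans <| sum_le_sum fun x _ => sum_le_sum fun y _ => sum_le_sum fun z _ =>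
      pointwise x y z
  have ec : ∑ z, negMulLog (c z) = -∑ x, ∑ y, ∑ z, p x y z * log (c z) := by
    rw [swap fun x y z => p x y z * log (c z), ← sum_neg_distrib]
    refine sum_congr rfl fun z _ => ?_
    simp_rw [← sum_mul]
    rw [negMulLog, neg_mul]
  have ea : ∑ x, ∑ z, negMulLog (a x z) = -∑ x, ∑ y, ∑ z, p x y z * log (a x z) := by
    rw [← sum_neg_distrib]
    refine sum_congr rfl fun x _ => ?_
    rw [sum_comm, ← sum_neg_distrib]
    refine sum_congr rfl fun z _ => ?_
    rw [← sum_mul, negMulLog, neg_mul]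
  have eb : ∑ y, ∑ z, negMulLog (b y z) = -∑ x, ∑ y, ∑ z, p x y z * log (b y z) := by
    rw [sum_comm (s := (univ : Finset S)), ← sum_neg_distrib]
    refine sum_congr rfl fun y _ => ?_
    rw [sum_comm, ← sum_neg_distrib]
    refine sum_congr rfl fun z _ => ?_
    rw [← sum_mul, negMulLog, neg_mul]
  have ep : ∑ x, ∑ y, ∑ z, negMulLog (p x y z) = -∑ x, ∑ y, ∑ z, p x y z * log (p x y z) := by
    simp only [negMulLog, neg_mul, sum_neg_distrib]
  simp only [sum_sub_distrib, sum_add_distrib] at pointwise_sum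
  rw [ec, ea, eb, ep]
  linarith

theorem preimage_mem_singleton {Ω : Type*} (B : Set Ω) (q : Prop) :
    (fun ω => ω ∈ B) ⁻¹' {q} = {ω | ω ∈ B ↔ q} := by
  ext ω
  simp

/-- The Shannon entropy of a random variable, as the mean of its information content. -/
noncomputable def entropy {Ω S : Type*} [MeasurableSpace Ω] (μ : Measure Ω) (X : Ω → S) : ℝ :=
  ∫ ω, -Real.log (μ.real {ω' | X ω' = X ω}) ∂μ

section Entropy

open Real Finset

variable {Ω S T U : Type*} [MeasurableSpace Ω] {μ : Measure Ω}
  [Fintype S] [MeasurableSpace S] [MeasurableSingletonClass S]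
  [Fintype T] [MeasurableSpace T] [MeasurableSingletonClass T]
  [Fintype U] [MeasurableSpace U] [MeasurableSingletonClass U]

theorem entropy_congr {S T : Type*} {X : Ω → S} {Y : Ω → T}
    (h : ∀ ω ω', X ω = X ω' ↔ Y ω = Y ω') : entropy μ X = entropy μ Y := by
  simp only [entropy, h]

theorem entropy_const [IsProbabilityMeasure μ] {S : Type*} (x : S) :
    entropy μ (fun _ => x) = 0 := by
  simp [entropy]

theorem entropy_eq_sum [IsProbabilityMeasure μ] {X : Ω → S} (hX : Measurable X) :
    entropy μ X = ∑ x, negMulLog (μ.real (X ⁻¹' {x})) := by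
  have h1 := integral_map (μ := μ) hX.aemeasurable
    (f := fun x => -log (μ.real (X ⁻¹' {x}))) (.of_discrete)
  rw [integral_fintype .of_finite] at h1
  refine h1.symm.trans (sum_congr rfl fun x _ => ?_)
  rw [map_measureReal_apply hX (measurableSet_singleton x)]
  simp [negMulLog]

theorem measureReal_eq_sum_inter_preimage [IsProbabilityMeasure μ] {Y : Ω → T} (hY : Measurable Y)
    (E : Set Ω) : μ.real E = ∑ y, μ.real (E ∩ Y ⁻¹' {y}) := by
  have := sum_measureReal_preimage_singleton (μ := μ.restrict E) univ (f := Y)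
    (fun y _ => hY (measurableSet_singleton y))
  simp only [coe_univ, Set.preimage_univ, measureReal_restrict_apply_univ] at this
  rw [← this]
  refine sum_congr rfl fun y _ => ?_
  rw [measureReal_restrict_apply (hY (measurableSet_singleton y)), Set.inter_comm]

theorem entropy_submodular [IsProbabilityMeasure μ] {X : Ω → S} {Y : Ω → T} {Z : Ω → U}
    (hX : Measurable X) (hY : Measurable Y) (hZ : Measurable Z) :
    entropy μ (fun ω => (X ω, Y ω, Z ω)) + entropy μ Z ≤
      entropy μ (fun ω => (X ω, Z ω)) + entropy μ (fun ω => (Y ω, Z ω)) := by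
  have key := sum_negMulLog_submodular
    (fun x y z => μ.real (X ⁻¹' {x} ∩ Y ⁻¹' {y} ∩ Z ⁻¹' {z})) (fun _ _ _ => measureReal_nonneg)
  have mX := fun x => hX (measurableSet_singleton x)
  have mY := fun y => hY (measurableSet_singleton y)
  have mZ := fun z => hZ (measurableSet_singleton z)
  have e1 : ∀ x z, ∑ y, μ.real (X ⁻¹' {x} ∩ Y ⁻¹' {y} ∩ Z ⁻¹' {z}) =
      μ.real (X ⁻¹' {x} ∩ Z ⁻¹' {z}) := by
    intro x z
    rw [measureReal_eq_sum_inter_preimage hY]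
    simp only [Set.inter_right_comm]
  have e2 : ∀ y z, ∑ x, μ.real (X ⁻¹' {x} ∩ Y ⁻¹' {y} ∩ Z ⁻¹' {z}) =
      μ.real (Y ⁻¹' {y} ∩ Z ⁻¹' {z}) := by
    intro y z
    rw [measureReal_eq_sum_inter_preimage hX]
    refine sum_congr rfl fun x _ => ?_
    rw [Set.inter_assoc, Set.inter_comm]
  have e3 : ∀ z, ∑ x, μ.real (X ⁻¹' {x} ∩ Z ⁻¹' {z}) = μ.real (Z ⁻¹' {z}) := by
    intro z
    rw [measureReal_eq_sum_inter_preimage hX]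
    simp only [Set.inter_comm]
  simp only [e1, e2, e3] at key
  rw [entropy_eq_sum hZ, entropy_eq_sum (hX.prodMk hZ), entropy_eq_sum (hY.prodMk hZ),
    entropy_eq_sum (hX.prodMk (hY.prodMk hZ))]
  simp only [Fintype.sum_prod_type, ← Set.singleton_prod_singleton, Set.mk_preimage_prod,
    ← Set.inter_assoc]
  exact key

theorem entropy_le_entropy_prod [IsProbabilityMeasure μ] {X : Ω → S} {Z : Ω → U}
    (hX : Measurable X) (hZ : Measurable Z) :
    entropy μ Z ≤ entropy μ (fun ω => (X ω, Z ω)) := by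
  have h1 := entropy_submodular (μ := μ) hX hX hZ
  have h2 : entropy μ (fun ω => (X ω, X ω, Z ω)) = entropy μ (fun ω => (X ω, Z ω)) :=
    entropy_congr fun ω ω' => by simp
  linarith

theorem entropy_comp [IsProbabilityMeasure μ] {φ : Ω → Ω} (hφ : MeasurePreserving φ μ μ)
    {X : Ω → S} (hX : Measurable X) : entropy μ (X ∘ φ) = entropy μ X := by
  rw [entropy_eq_sum hX, entropy_eq_sum (hX.comp hφ.measurable)]
  refine sum_congr rfl fun x _ => ?_
  rw [Set.preimage_comp,
    hφ.measureReal_preimage (hX (measurableSet_singleton x)).nullMeasurableSet]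

theorem entropy_mem [IsProbabilityMeasure μ] {B : Set Ω} (hB : MeasurableSet B) :
    entropy μ (fun ω => ω ∈ B) = binEntropy (μ.real B) := by
  rw [entropy_eq_sum hB.mem, binEntropy_eq_negMulLog_add_negMulLog_one_sub,
    ← probReal_compl_eq_one_sub hB, Fintype.univ_Prop, sum_pair (by simp)]
  simp only [preimage_mem_singleton, iff_true, iff_false]
  rfl

theorem entropy_mem_prod_sub_le_binEntropy [IsProbabilityMeasure μ] {Y : Ω → T}
    (hY : Measurable Y) {B C : Set Ω} (hB : MeasurableSet B) (hC : MeasurableSet C)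
    (hCY : ∀ ω ω', Y ω = Y ω' → (ω ∈ C ↔ ω' ∈ C)) :
    entropy μ (fun ω => (ω ∈ B, Y ω)) - entropy μ Y ≤ binEntropy (μ.real (symmDiff B C)) := by
  have h1 : entropy μ (fun ω => (ω ∈ B, Y ω)) =
      entropy μ (fun ω => (ω ∈ symmDiff B C, Y ω, ())) := by
    refine entropy_congr fun ω ω' => ?_
    simp only [Prod.mk.injEq, and_true, eq_iff_iff, Set.mem_symmDiff]
    refine and_congr_left fun h => ?_
    have := hCY ω ω' h
    tauto
  have h2 := entropy_submodular (μ := μ) (hB.symmDiff hC).mem hY (measurable_const (a := ()))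
  rw [← h1, entropy_const] at h2
  have h3 : entropy μ (fun ω => (ω ∈ symmDiff B C, ())) = binEntropy (μ.real (symmDiff B C)) := by
    rw [← entropy_mem (hB.symmDiff hC)]
    exact entropy_congr fun ω ω' => by simp
  have h4 : entropy μ (fun ω => (Y ω, ())) = entropy μ Y :=
    entropy_congr fun ω ω' => by simp
  linarith

theorem min_mul_log_two_le {p q : ℝ} (hp : 0 ≤ p) (hq : 0 ≤ q) :
    min p q * log 2 ≤ negMulLog p + negMulLog q - negMulLog (p + q) := by
  wlog hpq : p ≤ q generalizing p q
  · rw [min_comm, add_comm p q]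
    linarith [this hq hp (le_of_not_ge hpq)]
  rw [min_eq_left hpq]
  rcases hp.eq_or_lt with rfl | hp
  · simp
  have h1 : log 2 + log p ≤ log (p + q) := by
    rw [← log_mul two_ne_zero hp.ne']
    exact log_le_log (by positivity) (by linarith)
  have h2 : log q ≤ log (p + q) := log_le_log (by linarith) (by linarith)
  have h3 := mul_le_mul_of_nonneg_left h1 hp.le
  have h4 := mul_le_mul_of_nonneg_left h2 hq
  simp only [negMulLog]
  linarith

theorem exists_symmDiff_preimage_mul_log_two_le [IsProbabilityMeasure μ] {Y : Ω → T}
    (hY : Measurable Y) {B : Set Ω} (hB : MeasurableSet B) :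
    ∃ D : Set T, μ.real (symmDiff B (Y ⁻¹' D)) * log 2 ≤
      entropy μ (fun ω => (ω ∈ B, Y ω)) - entropy μ Y := by
  have mY := fun y => hY (measurableSet_singleton y)
  set D : Set T := {y | μ.real (Bᶜ ∩ Y ⁻¹' {y}) ≤ μ.real (B ∩ Y ⁻¹' {y})} with hD
  have mD : MeasurableSet (Y ⁻¹' D) := hY (Set.toFinite D).measurableSet
  refine ⟨D, ?_⟩
  have h1 : ∀ y, μ.real (symmDiff B (Y ⁻¹' D) ∩ Y ⁻¹' {y}) =
      min (μ.real (B ∩ Y ⁻¹' {y})) (μ.real (Bᶜ ∩ Y ⁻¹' {y})) := by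
    intro y
    by_cases hy : y ∈ D
    · rw [min_eq_right hy]
      congr 1
      ext ω
      simp only [Set.mem_inter_iff, Set.mem_symmDiff, Set.mem_preimage, Set.mem_singleton_iff,
        Set.mem_compl_iff]
      refine and_congr_left fun h => ?_
      rw [h]
      tauto
    · rw [min_eq_left (le_of_not_ge hy)]
      congr 1
      ext ω
      simp only [Set.mem_inter_iff, Set.mem_symmDiff, Set.mem_preimage, Set.mem_singleton_iff]
      refine and_congr_left fun h => ?_
      rw [h]
      tauto
  have h2 : ∀ y, μ.real (Y ⁻¹' {y}) = μ.real (B ∩ Y ⁻¹' {y}) + μ.real (Bᶜ ∩ Y ⁻¹' {y}) := by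
    intro y
    rw [← measureReal_inter_add_sdiff (s := Y ⁻¹' {y}) hB, Set.inter_comm, Set.sdiff_eq,
      Set.inter_comm _ Bᶜ]
  rw [measureReal_eq_sum_inter_preimage hY, sum_mul,
    entropy_eq_sum hY, entropy_eq_sum (hB.mem.prodMk hY), Fintype.sum_prod_type,
    Fintype.univ_Prop, sum_pair (by simp), ← sum_add_distrib, ← sum_sub_distrib]
  refine sum_le_sum fun y _ => ?_
  rw [h1, h2]
  refine (min_mul_log_two_le measureReal_nonneg measureReal_nonneg).trans_eq ?_
  simp only [← Set.singleton_prod_singleton, Set.mk_preimage_prod, preimage_mem_singleton,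
    iff_true, iff_false]
  rfl

end Entropy

section Block

variable {A : Type} [MeasurableSpace A] {μ : Measure (ℤ → A)} {B : Set (ℤ → A)}

/-- The coordinates of `ω` in `s`, and for `j ∈ t` whether the shift of `ω` by `j` lies in `B`. -/
def block {A : Type} (B : Set (ℤ → A)) (s t : Finset ℤ) (ω : ℤ → A) : (s → A) × (t → Prop) :=
  (fun i => ω i, fun j => (fun n => ω (n + j)) ∈ B)

theorem block_eq_iff {A : Type} (B : Set (ℤ → A)) (s t : Finset ℤ) (ω ω' : ℤ → A) :
    block B s t ω = block B s t ω' ↔ (∀ i ∈ s, ω i = ω' i) ∧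
      ∀ j ∈ t, (fun n => ω (n + j)) ∈ B ↔ (fun n => ω' (n + j)) ∈ B := by
  simp [block, Prod.ext_iff, funext_iff]

/-- The joint entropy of the coordinates in `s` and the indicators of the translates of `B` by
`t`. -/
noncomputable def blockEntropy (μ : Measure (ℤ → A)) (B : Set (ℤ → A)) (s t : Finset ℤ) : ℝ :=
  entropy μ (block B s t)

theorem coordSigma_le (K : Set ℤ) : coordSigma A K ≤ MeasurableSpace.pi :=
  iSup₂_le fun k _ => (measurable_pi_apply k).comap_le

theorem coordSigma_mono {K K' : Set ℤ} (h : K ⊆ K') : coordSigma A K ≤ coordSigma A K' :=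
  biSup_mono h

theorem measurable_coordSigma_restrict {K : Set ℤ} {s : Finset ℤ} (hs : ↑s ⊆ K) :
    Measurable[coordSigma A K] fun (ω : ℤ → A) (i : s) => ω i := by
  refine @measurable_pi_lambda _ _ _ (coordSigma A K) _ _ fun i => ?_
  rw [measurable_iff_comap_le]
  exact le_iSup₂_of_le (i : ℤ) (hs i.2) le_rfl

theorem measurable_block (hB : MeasurableSet B) (s t : Finset ℤ) : Measurable (block B s t) := by
  refine Measurable.prodMk (measurable_pi_lambda _ fun i => measurable_pi_apply _)
    (measurable_pi_lambda _ fun j => ?_)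
  exact hB.mem.comp (measurable_pi_lambda _ fun n => measurable_pi_apply _)

theorem blockEntropy_empty [IsProbabilityMeasure μ] : blockEntropy μ B ∅ ∅ = 0 := by
  rw [blockEntropy, ← entropy_const (μ := μ) ()]
  exact entropy_congr fun ω ω' => by simp [block_eq_iff]

theorem blockEntropy_singleton (s : Finset ℤ) : blockEntropy μ B s {0} =
    entropy μ (fun ω => (ω ∈ B, block B s ∅ ω)) :=
  entropy_congr fun ω ω' => by
    simp only [block_eq_iff, Prod.mk.injEq]
    simp [and_comm]

variable [Fintype A] [MeasurableSingletonClass A]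

theorem blockEntropy_submodular [IsProbabilityMeasure μ] (hB : MeasurableSet B)
    (s s' t t' : Finset ℤ) :
    blockEntropy μ B (s ∪ s') (t ∪ t') + blockEntropy μ B (s ∩ s') (t ∩ t') ≤
      blockEntropy μ B s t + blockEntropy μ B s' t' := by
  have key := entropy_submodular (μ := μ) (measurable_block hB s t) (measurable_block hB s' t')
    (measurable_block hB (s ∩ s') (t ∩ t'))
  refine (add_le_add_left (entropy_congr fun ω ω' => ?_).le _).trans
    (key.trans (add_le_add (entropy_congr fun ω ω' => ?_).le (entropy_congr fun ω ω' => ?_).le))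
  all_goals
    simp only [Prod.mk.injEq, block_eq_iff, Finset.mem_union, Finset.mem_inter]
    grind

theorem blockEntropy_mono [IsProbabilityMeasure μ] (hB : MeasurableSet B)
    (s s' t t' : Finset ℤ) (hs : s ⊆ s') (ht : t ⊆ t') :
    blockEntropy μ B s t ≤ blockEntropy μ B s' t' := by
  refine (entropy_le_entropy_prod (measurable_block hB s' t') (measurable_block hB s t)).trans_eq
    (entropy_congr fun ω ω' => ?_)
  simp only [Prod.mk.injEq, block_eq_iff]
  grind

theorem blockEntropy_shift [IsProbabilityMeasure μ] (hstat : MeasurePreserving (shiftZ (A := A)) μ μ)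
    (hB : MeasurableSet B) (k : ℤ) (s t : Finset ℤ) :
    blockEntropy μ B (s.image (· + k)) (t.image (· + k)) = blockEntropy μ B s t := by
  have one : ∀ s t : Finset ℤ,
      blockEntropy μ B (s.image (· + 1)) (t.image (· + 1)) = blockEntropy μ B s t := by
    intro s t
    rw [blockEntropy, blockEntropy, ← entropy_comp hstat (measurable_block hB s t)]
    refine entropy_congr fun ω ω' => ?_
    simp only [Function.comp, block_eq_iff, Finset.forall_mem_image, shiftZ, add_assoc]
  induction k using Int.induction_on with
  | zero => simp
  | succ i ih =>
    rw [← ih, ← one (s.image (· + (i : ℤ))) (t.image (· + (i : ℤ)))]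
    simp only [Finset.image_image, Function.comp_def, add_assoc]
  | pred i ih =>
    rw [← ih, ← one (s.image (· + (-(i : ℤ) - 1))) (t.image (· + (-(i : ℤ) - 1)))]
    simp only [Finset.image_image, Function.comp_def, add_assoc, sub_add_cancel]

theorem exists_finset_symmDiff_lt [IsProbabilityMeasure μ] {K : Set ℤ}
    (hB : MeasurableSet[coordSigma A K] B) {ε : ENNReal} (hε : 0 < ε) :
    ∃ s : Finset ℤ, ↑s ⊆ K ∧ ∃ C, MeasurableSet[coordSigma A K] C ∧
      (∀ ω ω', (∀ i ∈ s, ω i = ω' i) → (ω ∈ C ↔ ω' ∈ C)) ∧ μ (symmDiff B C) < ε := by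
  set 𝒞 : Set (Set (ℤ → A)) := {C | ∃ s : Finset ℤ, ↑s ⊆ K ∧
    ∀ ω ω', (∀ i ∈ s, ω i = ω' i) → (ω ∈ C ↔ ω' ∈ C)} with h𝒞
  have meas : ∀ C ∈ 𝒞, MeasurableSet[coordSigma A K] C := by
    rintro C ⟨s, hs, hC⟩
    have h := measurable_coordSigma_restrict (A := A) hs
      (Set.toFinite ((fun (ω : ℤ → A) (i : s) => ω i) '' C)).measurableSet
    convert h using 1
    ext ω
    constructor
    · exact fun hω => ⟨ω, hω, rfl⟩
    · rintro ⟨ω', hω', h⟩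
      exact (hC ω' ω fun i hi => congrFun h ⟨i, hi⟩).1 hω'
  have ring : IsSetRing 𝒞 := by
    refine ⟨⟨∅, by simp, by simp⟩, ?_, ?_⟩
    all_goals
      rintro C C' ⟨s, hs, hC⟩ ⟨s', hs', hC'⟩
      refine ⟨s ∪ s', by simp [hs, hs'], fun ω ω' h => ?_⟩
      have h1 := hC ω ω' fun i hi => h i (Finset.mem_union_left _ hi)
      have h2 := hC' ω ω' fun i hi => h i (Finset.mem_union_right _ hi)
      simp only [Set.mem_union, Set.mem_sdiff, h1, h2]
  have gen : coordSigma A K = MeasurableSpace.generateFrom 𝒞 := by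
    refine le_antisymm (iSup₂_le fun k hk => ?_) (MeasurableSpace.generateFrom_le meas)
    rintro _ ⟨U, -, rfl⟩
    refine MeasurableSpace.measurableSet_generateFrom ⟨{k}, by simpa using hk, fun ω ω' h => ?_⟩
    simp [h k (Finset.mem_singleton_self k)]
  obtain ⟨C, hC, hlt⟩ := @exists_measure_symmDiff_lt_of_generateFrom_isSetRing _
    (coordSigma A K) (μ.trim (coordSigma_le K)) _ 𝒞 ring
    ⟨{Set.univ}, Set.countable_singleton _, by
      rw [Set.singleton_subset_iff]
      exact ⟨∅, by simp, by simp⟩, by simp⟩ gen B hB ε hε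
  rw [trim_measurableSet_eq _ ((meas C hC).symmDiff hB), symmDiff_comm] at hlt
  obtain ⟨s, hs, hC'⟩ := id hC
  exact ⟨s, hs, C, meas C hC, hC', hlt⟩

theorem exists_blockEntropy_sub_lt [IsProbabilityMeasure μ] {K : Set ℤ}
    (hB : MeasurableSet[coordSigma A K] B) {ε : ℝ} (hε : 0 < ε) :
    ∃ s : Finset ℤ, ↑s ⊆ K ∧ blockEntropy μ B s {0} - blockEntropy μ B s ∅ < ε := by
  have hlim := Real.binEntropy_continuous.tendsto 0
  rw [Real.binEntropy_zero] at hlim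
  obtain ⟨δ, hδ, hδε⟩ := Metric.eventually_nhds_iff.1 (hlim.eventually_lt_const hε)
  obtain ⟨s, hs, C, hC, hCs, hlt⟩ :=
    exists_finset_symmDiff_lt (μ := μ) hB (ENNReal.ofReal_pos.2 hδ)
  have hB' := coordSigma_le K _ hB
  refine ⟨s, hs, ?_⟩
  rw [blockEntropy_singleton, blockEntropy]
  refine (entropy_mem_prod_sub_le_binEntropy (measurable_block hB' s ∅) hB'
    (coordSigma_le K _ hC) fun ω ω' h => hCs ω ω' ((block_eq_iff _ _ _ _ _).1 h).1).trans_lt ?_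
  refine hδε ?_
  rw [Real.dist_0_eq_abs, abs_of_nonneg measureReal_nonneg]
  exact ENNReal.toReal_lt_of_lt_ofReal hlt

theorem exists_measurableSet_symmDiff_lt [IsProbabilityMeasure μ] (hB : MeasurableSet B)
    {s : Finset ℤ} {ε : ℝ}
    (h : blockEntropy μ B s {0} - blockEntropy μ B s ∅ < ε * Real.log 2) :
    ∃ C, MeasurableSet[coordSigma A s] C ∧ μ.real (symmDiff B C) < ε := by
  rw [blockEntropy_singleton, blockEntropy] at h
  obtain ⟨D, hD⟩ := exists_symmDiff_preimage_mul_log_two_le (μ := μ) (measurable_block hB s ∅) hB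
  refine ⟨block B s ∅ ⁻¹' D, ?_, lt_of_mul_lt_mul_right (hD.trans_lt h) (by positivity)⟩
  have hm : Measurable[coordSigma A s] (block B s ∅) :=
    Measurable.prodMk (measurable_coordSigma_restrict subset_rfl)
      (@measurable_pi_lambda _ _ _ (coordSigma A s) _ _ fun j => absurd j.2 (Finset.notMem_empty _))
  exact hm (Set.toFinite D).measurableSet

open Filter in
theorem exists_tail_symmDiff_eq_zero [IsProbabilityMeasure μ] (hB : MeasurableSet B)
    {K : ℕ → Set ℤ} (hK : Antitone K)
    (h : ∀ m, ∀ ε > 0, ∃ s : Finset ℤ, ↑s ⊆ K m ∧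
      blockEntropy μ B s {0} - blockEntropy μ B s ∅ < ε) :
    ∃ C, MeasurableSet[⨅ m, coordSigma A (K m)] C ∧ μ (symmDiff B C) = 0 := by
  have h1 : ∀ m, ∃ C, MeasurableSet[coordSigma A (K m)] C ∧
      μ.real (symmDiff B C) < (1 / 2 : ℝ) ^ m := by
    intro m
    obtain ⟨s, hs, hlt⟩ := h m ((1 / 2 : ℝ) ^ m * Real.log 2) (by positivity)
    obtain ⟨C, hC, hC'⟩ := exists_measurableSet_symmDiff_lt hB hlt
    exact ⟨C, coordSigma_mono hs _ hC, hC'⟩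
  choose C hC hlt using h1
  refine ⟨limsup C atTop, ?_, ?_⟩
  · rw [MeasurableSpace.measurableSet_iInf]
    intro m
    rw [← limsup_nat_add C m]
    exact @MeasurableSet.measurableSet_limsup _ (coordSigma A (K m)) _ fun n =>
      coordSigma_mono (hK (Nat.le_add_left m n)) _ (hC (n + m))
  · refine measure_mono_null ?_ (measure_limsup_atTop_eq_zero
      (s := fun n => symmDiff B (C n)) (ne_top_of_le_ne_top
        summable_geometric_two.tsum_ofReal_ne_top (ENNReal.tsum_le_tsum fun n => ?_)))
    · intro ω hω
      rw [mem_limsup_iff_frequently_mem]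
      rcases hω with ⟨h1, h2⟩ | ⟨h1, h2⟩
      · rw [mem_limsup_iff_frequently_mem, not_frequently] at h2
        exact (h2.mono fun n hn => Or.inl ⟨h1, hn⟩).frequently
      · rw [mem_limsup_iff_frequently_mem] at h1
        exact h1.mono fun n hn => Or.inr ⟨hn, h2⟩
    · rw [← ofReal_measureReal]
      exact ENNReal.ofReal_le_ofReal (hlt n).le

theorem exists_futureTail_of_pastTail [IsProbabilityMeasure μ]
    (hstat : MeasurePreserving (shiftZ (A := A)) μ μ) (hB : MeasurableSet[pastTail A] B) :
    ∃ C, MeasurableSet[futureTail A] C ∧ μ (symmDiff B C) = 0 := by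
  rw [pastTail, MeasurableSpace.measurableSet_iInf] at hB
  have hB' := coordSigma_le _ _ (hB 0)
  refine exists_tail_symmDiff_eq_zero hB' (K := fun m : ℕ => Set.Ici (m : ℤ))
    (fun a b hab => Set.Ici_subset_Ici.2 (by exact_mod_cast hab)) fun m =>
    exists_future_of_exists_past (blockEntropy μ B) (blockEntropy_mono hB')
      (blockEntropy_submodular hB') blockEntropy_empty (blockEntropy_shift hstat hB') ?_ m
  intro m ε hε
  obtain ⟨s, hs, hlt⟩ := exists_blockEntropy_sub_lt (μ := μ) (hB m.natAbs) hε
  refine ⟨s, fun i hi => ?_, hlt⟩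
  have : i ≤ -(m.natAbs : ℤ) := hs hi
  lia

theorem exists_pastTail_of_futureTail [IsProbabilityMeasure μ]
    (hstat : MeasurePreserving (shiftZ (A := A)) μ μ) (hB : MeasurableSet[futureTail A] B) :
    ∃ C, MeasurableSet[pastTail A] C ∧ μ (symmDiff B C) = 0 := by
  rw [futureTail, MeasurableSpace.measurableSet_iInf] at hB
  have hB' := coordSigma_le _ _ (hB 0)
  refine exists_tail_symmDiff_eq_zero hB' (K := fun m : ℕ => Set.Iic (-(m : ℤ)))
    (fun a b hab => Set.Iic_subset_Iic.2 (by simpa using hab)) fun m ε hε => ?_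
  obtain ⟨s, hs, hlt⟩ := exists_future_of_exists_past
    (fun s t => blockEntropy μ B (s.image Neg.neg) (t.image Neg.neg))
    (fun s s' t t' hs ht => blockEntropy_mono hB' _ _ _ _
      (Finset.image_subset_image hs) (Finset.image_subset_image ht))
    (fun s s' t t' => by
      simp only [Finset.image_union, Finset.image_inter _ _ neg_injective]
      exact blockEntropy_submodular hB' _ _ _ _)
    blockEntropy_empty
    (fun k s t => by
      rw [← blockEntropy_shift hstat hB' (-k) (s.image Neg.neg)]
      simp only [Finset.image_image, Function.comp_def, neg_add])
    (fun m ε hε => by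
      obtain ⟨s, hs, hlt⟩ := exists_blockEntropy_sub_lt (μ := μ) (hB m.natAbs) hε
      refine ⟨s.image Neg.neg, fun i hi => ?_, ?_⟩
      · obtain ⟨i, his, rfl⟩ := Finset.mem_image.1 hi
        have : (m.natAbs : ℤ) ≤ i := hs his
        lia
      · simpa [Finset.image_image, Function.comp_def] using hlt) m ε hε
  refine ⟨s.image Neg.neg, fun i hi => ?_, by simpa using hlt⟩
  obtain ⟨i, his, rfl⟩ := Finset.mem_image.1 (Finset.mem_coe.1 hi)
  exact neg_le_neg (hs i his)

end Block

theorem measure_symmDiff_eq_zero_trans {Ω : Type*} [MeasurableSpace Ω] {μ : Measure Ω}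
    {S B C : Set Ω} (hSB : μ (symmDiff S B) = 0) (hBC : μ (symmDiff B C) = 0) :
    μ (symmDiff S C) = 0 := by
  rw [measure_symmDiff_eq_zero_iff] at *
  exact hSB.trans hBC

/-- For a stationary measure `μ` on `A^ℤ` with `A` finite, the `μ`-completions of the
past tail and the future tail σ-algebras coincide: a set differs from a past-tail
measurable set by a `μ`-null set iff it differs from a future-tail measurable set by a
`μ`-null set. -/
theorem past_tail_completion_eq_future_tail_completion
    {A : Type} [Fintype A] [Nonempty A]
    [MeasurableSpace A] [MeasurableSingletonClass A]
    (μ : Measure (ℤ → A)) [IsProbabilityMeasure μ]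
    (hstat : MeasurePreserving (shiftZ (A := A)) μ μ) :
    {S : Set (ℤ → A) | ∃ B, MeasurableSet[pastTail A] B ∧ μ (symmDiff S B) = 0} =
      {S : Set (ℤ → A) | ∃ B, MeasurableSet[futureTail A] B ∧ μ (symmDiff S B) = 0} := by
  ext S
  constructor
  · rintro ⟨B, hB, hSB⟩
    obtain ⟨C, hC, hBC⟩ := exists_futureTail_of_pastTail hstat hB
    exact ⟨C, hC, measure_symmDiff_eq_zero_trans hSB hBC⟩
  · rintro ⟨B, hB, hSB⟩
    obtain ⟨C, hC, hBC⟩ := exists_pastTail_of_futureTail hstat hB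
    exact ⟨C, hC, measure_symmDiff_eq_zero_trans hSB hBC⟩
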